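/- arXiv:2311.04369 — 2 statements merged into one kernel-verified Lean document; each statement's English description precedes it below -/
import Mathlib

section
/- Let N, S*, ε, μ, ω, v, α, β, p, μ_S be real numbers with N > 0, ε + μ > 0, ω + μ > 0, v + μ_S > 0. Let F be the 3×3 real matrix with first row (0, αS*/N, βS*/N) and all other entries 0, and let D be the 3×3 real matrix with rows (ε+μ, 0, 0), (−ε, ω+μ, 0), (0, −(1−p)ω, v+μ_S). Then D is invertible and the spectrum of the matrix F·D⁻¹ over ℝ is {0, R₀}, where R₀ = S*·ε·(α(v+μ_S) + β·ω(1−p)) / (N(ε+μ)(ω+μ)(v+μ_S)). -/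
/-- The next-generation matrix `F * D⁻¹` of the single-strain SEIR
COVID-19 model at the disease-free equilibrium has spectrum `{0, R₀}`, where
`R₀ = S*·ε·(α(v+μS) + β·ω(1−p)) / (N(ε+μ)(ω+μ)(v+μS))`, and `D` is invertible. -/
theorem ess_covid_next_generation_spectrum
    (N Sstar ε μ ω v α β p μS : ℝ)
    (hN : 0 < N) (hεμ : 0 < ε + μ) (hωμ : 0 < ω + μ) (hv : 0 < v + μS) :
    let F : Matrix (Fin 3) (Fin 3) ℝ :=
      !![0, α * Sstar / N, β * Sstar / N; 0, 0, 0; 0, 0, 0]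
    let D : Matrix (Fin 3) (Fin 3) ℝ :=
      !![ε + μ, 0, 0; -ε, ω + μ, 0; 0, -((1 - p) * ω), v + μS]
    IsUnit D.det ∧
      spectrum ℝ (F * D⁻¹) =
        {0, Sstar * ε * (α * (v + μS) + β * ω * (1 - p)) /
            (N * (ε + μ) * (ω + μ) * (v + μS))} := by
  intro F D
  have hdet : IsUnit D.det := by
    rw [isUnit_iff_ne_zero]
    have : D.det = (ε + μ) * (ω + μ) * (v + μS) := by
      simp [D, Matrix.det_fin_three]
    rw [this]; positivity
  refine ⟨hdet, ?_⟩
  set R : ℝ := Sstar * ε * (α * (v + μS) + β * ω * (1 - p)) /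
            (N * (ε + μ) * (ω + μ) * (v + μS)) with hR
  obtain ⟨m2, hm2⟩ : ∃ m2, m2 = β * Sstar / (N * (v + μS)) := ⟨_, rfl⟩
  obtain ⟨m1, hm1⟩ : ∃ m1, m1 = (α * Sstar / N + m2 * ((1 - p) * ω)) / (ω + μ) := ⟨_, rfl⟩
  have e2 : m2 * (v + μS) = β * Sstar / N := by
    rw [hm2]; field_simp
  have e1 : m1 * (ω + μ) + -(m2 * ((1 - p) * ω)) = α * Sstar / N := by
    rw [hm1]; field_simp; ring
  have e0 : R * (ε + μ) + -(m1 * ε) = 0 := by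
    rw [hR, hm1, hm2]; field_simp; ring
  have hF : F = !![R, m1, m2; 0, 0, 0; 0, 0, 0] * D := by
    ext i j
    fin_cases i <;> fin_cases j <;>
      simp [F, D, Matrix.mul_apply, Fin.sum_univ_three, e0, e1, e2]
  rw [hF, Matrix.mul_nonsing_inv_cancel_right _ _ hdet]
  ext x
  rw [spectrum.mem_iff, Matrix.isUnit_iff_isUnit_det, isUnit_iff_ne_zero, not_not]
  have : (algebraMap ℝ (Matrix (Fin 3) (Fin 3) ℝ) x - !![R, m1, m2; 0, 0, 0; 0, 0, 0]).det
      = (x - R) * x * x := by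
    simp [Matrix.det_fin_three, Matrix.algebraMap_matrix_apply]
  rw [this]
  simp only [mul_eq_zero, sub_eq_zero, Set.mem_insert_iff, Set.mem_singleton_iff]
  tauto
end

section
/- Let ω > 0, 0 ≤ p < 1, let α, β : ℝ → ℝ be twice continuously differentiable, and define G(μ, v) = α'(μ)(v+μ)² + (1−p)ω·(β'(μ)(v+μ) − β(μ)). Suppose at (μ*, v) with v + μ* > 0 we have G(μ*, v) = 0. Then ∂G/∂v (μ*, v) = ((1−p)ω/(v+μ*))·(2β(μ*) − β'(μ*)(v+μ*)); in particular ∂G/∂v (μ*, v) > 0 if and only if β'(μ*) < 2β(μ*)/(v+μ*). -/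
/-- For `G(μ, v) = α'(μ)(v+μ)² + (1−p)ω·(β'(μ)(v+μ) − β(μ))`
(the rescaled stationarity function of the two-transmission SEIR fitness), at a
zero `(μ*, v)` of `G` one has
`∂G/∂v(μ*,v) = ((1−p)ω/(v+μ*))·(2β(μ*) − β'(μ*)(v+μ*))`, which is positive iff
`β'(μ*) < 2β(μ*)/(v+μ*)`. -/
theorem ess_covid_two_transmission_sensitivity_recovery
    (ω p : ℝ) (hω : 0 < ω) (hp0 : 0 ≤ p) (hp1 : p < 1)
    (α β : ℝ → ℝ) (hα : ContDiff ℝ 2 α) (hβ : ContDiff ℝ 2 β)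
    (μstar v : ℝ) (hv : 0 < v + μstar)
    (G : ℝ → ℝ → ℝ)
    (hG : G = fun μ w => deriv α μ * (w + μ) ^ 2 +
      (1 - p) * ω * (deriv β μ * (w + μ) - β μ))
    (hcrit : G μstar v = 0) :
    deriv (G μstar) v =
        (1 - p) * ω / (v + μstar) * (2 * β μstar - deriv β μstar * (v + μstar)) ∧
      (0 < deriv (G μstar) v ↔ deriv β μstar < 2 * β μstar / (v + μstar)) := by
  subst hG
  have hd : HasDerivAt (fun w : ℝ => deriv α μstar * (w + μstar) ^ 2 +
      (1 - p) * ω * (deriv β μstar * (w + μstar) - β μstar))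
      (2 * deriv α μstar * (v + μstar) + (1 - p) * ω * deriv β μstar) v := by
    have h1 : HasDerivAt (fun w : ℝ => w + μstar) 1 v := (hasDerivAt_id' v).add_const μstar
    have h2 := ((h1.pow 2).const_mul (deriv α μstar)).add
      (((h1.const_mul (deriv β μstar)).sub_const (β μstar)).const_mul ((1 - p) * ω))
    refine h2.congr_deriv ?_
    norm_num
    ring
  have key : deriv (fun w : ℝ => deriv α μstar * (w + μstar) ^ 2 +
      (1 - p) * ω * (deriv β μstar * (w + μstar) - β μstar)) v =
      (1 - p) * ω / (v + μstar) * (2 * β μstar - deriv β μstar * (v + μstar)) := by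
    rw [hd.deriv, div_mul_eq_mul_div, eq_div_iff hv.ne']
    have hc : deriv α μstar * (v + μstar) ^ 2 +
      (1 - p) * ω * (deriv β μstar * (v + μstar) - β μstar) = 0 := hcrit
    linear_combination 2 * hc
  refine ⟨key, ?_⟩
  have hc : 0 < (1 - p) * ω / (v + μstar) := div_pos (mul_pos (by linarith) hω) hv
  change 0 < deriv (fun w : ℝ => deriv α μstar * (w + μstar) ^ 2 +
      (1 - p) * ω * (deriv β μstar * (w + μstar) - β μstar)) v ↔ _
  rw [key, mul_pos_iff_of_pos_left hc, sub_pos, lt_div_iff₀ hv]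
end
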